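/- Let J₆(x,y) = −1+12x²−4x³−9x⁴+6x⁵−x⁶−24√3x²y+18√3x⁴y−6√3x⁵y+12y²+12xy²−18x²y²−12x³y²+15x⁴y²+8√3y³+12√3x²y³+20√3x³y³−9y⁴−18xy⁴−15x²y⁴−6√3y⁵−6√3xy⁵+y⁶ and let f ∈ ℂ[x,y,z] be f = J₆(x,y) + (z⁶ − 12z⁵ + 54z⁴ − 108z³ + 81z²)/16. Then the complex vector space ℂ[x,y,z]/⟨f, ∂f/∂x, ∂f/∂y, ∂f/∂z⟩ has dimension 67, i.e. the total Tjurina number of f is 67. -/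

import Mathlib

noncomputable section

/-- The bivariate sextic in the coordinates `x`, `v` with `y = √3 v`. -/
def JJ {R : Type*} [CommRing R] (x v : R) : R :=
  -1 + 36*v^2 + 12*x^2 + 72*v^3 + 36*x*v^2 - 72*x^2*v - 4*x^3 - 81*v^4 - 54*x^2*v^2 - 9*x^4 - 162*v^5 - 162*x*v^4 + 108*x^2*v^3 - 36*x^3*v^2 + 54*x^4*v + 6*x^5 + 27*v^6 - 162*x*v^5 - 135*x^2*v^4 + 180*x^3*v^3 + 45*x^4*v^2 - 18*x^5*v - x^6

/-- The `x`-derivative of `JJ`. -/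
def JX {R : Type*} [CommRing R] (x v : R) : R :=
  24*x + 36*v^2 - 144*x*v - 12*x^2 - 108*x*v^2 - 36*x^3 - 162*v^4 + 216*x*v^3 - 108*x^2*v^2 + 216*x^3*v + 30*x^4 - 162*v^5 - 270*x*v^4 + 540*x^2*v^3 + 180*x^3*v^2 - 90*x^4*v - 6*x^5

/-- The `v`-derivative of `JJ`. -/
def JV {R : Type*} [CommRing R] (x v : R) : R :=
  72*v + 216*v^2 + 72*x*v - 72*x^2 - 324*v^3 - 108*x^2*v - 810*v^4 - 648*x*v^3 + 324*x^2*v^2 - 72*x^3*v + 54*x^4 + 162*v^5 - 810*x*v^4 - 540*x^2*v^3 + 540*x^3*v^2 + 90*x^4*v - 18*x^5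

lemma certA0 {R : Type*} [CommRing R] (x v : R) :
    ((20736 : ℤ) : R) * (x^0*v^5) =
      (((-144 : ℤ) : R) * (x^0*v^1) + ((-216 : ℤ) : R) * (x^0*v^2) + ((8208 : ℤ) : R) * (x^0*v^3) + ((648 : ℤ) : R) * (x^0*v^4) + ((-1296 : ℤ) : R) * (x^1*v^0) + ((9072 : ℤ) : R) * (x^1*v^1) + ((2592 : ℤ) : R) * (x^1*v^2) + ((-31968 : ℤ) : R) * (x^1*v^3) + ((1512 : ℤ) : R) * (x^2*v^0) + ((-7344 : ℤ) : R) * (x^2*v^1) + ((-1296 : ℤ) : R) * (x^2*v^2) + ((-576 : ℤ) : R) * (x^3*v^0) + ((1440 : ℤ) : R) * (x^3*v^1) + ((72 : ℤ) : R) * (x^4*v^0))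
      + (-720*v + 720*x + 720*x*v - 720*x^2 + 2700*v^3 - 1620*x*v^2 + 180*x^2*v + 180*x^3) * JJ x v
      + (84 + 75*v - 75*x - 135*v^2 + 150*x*v - 135*x^2 - 405*v^3 + 45*x*v^2 - 15*x^2*v + 135*x^3 - 450*x*v^3 + 270*x^2*v^2 - 30*x^3*v - 30*x^4) * JX x v
      + (-8 - 15*v + 35*x + 255*v^2 - 150*x*v - 25*x^2 + 45*v^3 - 345*x*v^2 + 135*x^2*v + 5*x^3 - 450*v^4 + 270*x*v^3 - 30*x^2*v^2 - 30*x^3*v) * JV x v := by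
  simp only [JJ, JX, JV]
  push_cast
  ring

lemma certA1 {R : Type*} [CommRing R] (x v : R) :
    ((6912 : ℤ) : R) * (x^1*v^4) =
      (((-144 : ℤ) : R) * (x^0*v^0) + ((432 : ℤ) : R) * (x^0*v^1) + ((3672 : ℤ) : R) * (x^0*v^2) + ((-6696 : ℤ) : R) * (x^0*v^4) + ((48 : ℤ) : R) * (x^1*v^0) + ((144 : ℤ) : R) * (x^1*v^1) + ((432 : ℤ) : R) * (x^1*v^2) + ((-864 : ℤ) : R) * (x^1*v^3) + ((216 : ℤ) : R) * (x^2*v^0) + ((-864 : ℤ) : R) * (x^2*v^1) + ((-3888 : ℤ) : R) * (x^2*v^2) + ((-144 : ℤ) : R) * (x^3*v^0) + ((288 : ℤ) : R) * (x^3*v^1) + ((24 : ℤ) : R) * (x^4*v^0))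
      + (-144 - 144*v - 48*x + 720*v^2 - 144*x*v + 192*x^2 - 324*v^3 + 1116*x*v^2 + 324*x^2*v - 60*x^3) * JJ x v
      + (-4 + 3*v + 45*x + 21*v^2 + 78*x*v + 5*x^2 + 27*v^3 - 171*x*v^2 + 33*x^2*v - 33*x^3 + 54*x*v^3 - 186*x^2*v^2 - 54*x^3*v + 10*x^4) * JX x v
      + (-8 + 57*v - 5*x + 3*v^2 + 34*x*v + 11*x^2 - 147*v^3 + 15*x*v^2 - 57*x^2*v - 3*x^3 + 54*v^4 - 186*x*v^3 - 54*x^2*v^2 + 10*x^3*v) * JV x v := by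
  simp only [JJ, JX, JV]
  push_cast
  ring

lemma certA2 {R : Type*} [CommRing R] (x v : R) :
    ((6912 : ℤ) : R) * (x^2*v^3) =
      (((144 : ℤ) : R) * (x^0*v^1) + ((-648 : ℤ) : R) * (x^0*v^2) + ((-2160 : ℤ) : R) * (x^0*v^3) + ((-648 : ℤ) : R) * (x^0*v^4) + ((-432 : ℤ) : R) * (x^1*v^0) + ((3024 : ℤ) : R) * (x^1*v^1) + ((-9504 : ℤ) : R) * (x^1*v^3) + ((-72 : ℤ) : R) * (x^2*v^0) + ((1296 : ℤ) : R) * (x^2*v^1) + ((1296 : ℤ) : R) * (x^2*v^2) + ((288 : ℤ) : R) * (x^3*v^0) + ((-1440 : ℤ) : R) * (x^3*v^1) + ((-72 : ℤ) : R) * (x^4*v^0))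
      + (-144*v + 144*x + 432*v^2 + 144*x*v + 324*v^3 + 324*x*v^2 + 252*x^2*v - 36*x^3) * JJ x v
      + (24 + 21*v + 3*x - 9*v^2 + 66*x*v - 33*x^2 - 63*v^3 - 81*x*v^2 + 3*x^2*v - 3*x^3 - 54*x*v^3 - 54*x^2*v^2 - 42*x^3*v + 6*x^4) * JX x v
      + (-4 + 15*v + 5*x + 33*v^2 - 18*x*v + x^2 - 81*v^3 - 75*x*v^2 - 3*x^2*v - x^3 - 54*v^4 - 54*x*v^3 - 42*x^2*v^2 + 6*x^3*v) * JV x v := by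
  simp only [JJ, JX, JV]
  push_cast
  ring

lemma certA3 {R : Type*} [CommRing R] (x v : R) :
    ((2304 : ℤ) : R) * (x^3*v^2) =
      (((-48 : ℤ) : R) * (x^0*v^0) + ((144 : ℤ) : R) * (x^0*v^1) + ((1224 : ℤ) : R) * (x^0*v^2) + ((864 : ℤ) : R) * (x^0*v^3) + ((-216 : ℤ) : R) * (x^0*v^4) + ((-48 : ℤ) : R) * (x^1*v^0) + ((432 : ℤ) : R) * (x^1*v^1) + ((432 : ℤ) : R) * (x^1*v^2) + ((864 : ℤ) : R) * (x^1*v^3) + ((72 : ℤ) : R) * (x^2*v^0) + ((-3024 : ℤ) : R) * (x^2*v^2) + ((48 : ℤ) : R) * (x^3*v^0) + ((-288 : ℤ) : R) * (x^3*v^1) + ((-24 : ℤ) : R) * (x^4*v^0))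
      + (-48 - 144*v - 48*x + 288*v^2 - 144*x*v + 48*x^2 - 108*v^3 + 468*x*v^2 + 108*x^2*v + 12*x^3) * JJ x v
      + (-3*v + 11*x + 3*v^2 + 42*x*v + 11*x^2 + 9*v^3 - 81*x*v^2 + 27*x^2*v - 3*x^3 + 18*x*v^3 - 78*x^2*v^2 - 18*x^3*v - 2*x^4) * JX x v
      + (-4 + 23*v - 3*x + 21*v^2 + 22*x*v + 5*x^2 - 57*v^3 + 21*x*v^2 - 27*x^2*v - x^3 + 18*v^4 - 78*x*v^3 - 18*x^2*v^2 - 2*x^3*v) * JV x v := by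
  simp only [JJ, JX, JV]
  push_cast
  ring

lemma certA4 {R : Type*} [CommRing R] (x v : R) :
    ((2304 : ℤ) : R) * (x^4*v^1) =
      (((-144 : ℤ) : R) * (x^0*v^1) + ((-1944 : ℤ) : R) * (x^0*v^2) + ((-3888 : ℤ) : R) * (x^0*v^3) + ((648 : ℤ) : R) * (x^0*v^4) + ((-144 : ℤ) : R) * (x^1*v^0) + ((1008 : ℤ) : R) * (x^1*v^1) + ((-2592 : ℤ) : R) * (x^1*v^2) + ((-4320 : ℤ) : R) * (x^1*v^3) + ((-216 : ℤ) : R) * (x^2*v^0) + ((4752 : ℤ) : R) * (x^2*v^1) + ((-1296 : ℤ) : R) * (x^2*v^2) + ((1440 : ℤ) : R) * (x^3*v^1) + ((72 : ℤ) : R) * (x^4*v^0))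
      + (-144*v + 144*x + 864*v^2 + 144*x*v + 144*x^2 + 108*v^3 + 972*x*v^2 + 468*x^2*v - 108*x^3) * JJ x v
      + (12 + 27*v + 21*x + 9*v^2 + 102*x*v - 39*x^2 - 45*v^3 - 171*x*v^2 + 9*x^2*v - 33*x^3 - 18*x*v^3 - 162*x^2*v^2 - 78*x^3*v + 18*x^4) * JX x v
      + (33*v + 3*x + 15*v^2 - 6*x*v + 7*x^2 - 171*v^3 - 81*x*v^2 - 33*x^2*v - 3*x^3 - 18*v^4 - 162*x*v^3 - 78*x^2*v^2 + 18*x^3*v) * JV x v := by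
  simp only [JJ, JX, JV]
  push_cast
  ring

lemma certA5 {R : Type*} [CommRing R] (x v : R) :
    ((768 : ℤ) : R) * (x^5*v^0) =
      (((240 : ℤ) : R) * (x^0*v^0) + ((1584 : ℤ) : R) * (x^0*v^1) + ((1944 : ℤ) : R) * (x^0*v^2) + ((-1728 : ℤ) : R) * (x^0*v^3) + ((216 : ℤ) : R) * (x^0*v^4) + ((48 : ℤ) : R) * (x^1*v^0) + ((1296 : ℤ) : R) * (x^1*v^1) + ((-1296 : ℤ) : R) * (x^1*v^2) + ((-864 : ℤ) : R) * (x^1*v^3) + ((-3048 : ℤ) : R) * (x^2*v^0) + ((864 : ℤ) : R) * (x^2*v^1) + ((-3888 : ℤ) : R) * (x^2*v^2) + ((48 : ℤ) : R) * (x^3*v^0) + ((288 : ℤ) : R) * (x^3*v^1) + ((2328 : ℤ) : R) * (x^4*v^0))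
      + (240 - 720*v - 240*x - 720*v^2 - 720*x*v - 480*x^2 + 540*v^3 - 900*x*v^2 - 540*x^2*v + 420*x^3) * JJ x v
      + (-12 - 45*v - 115*x - 75*v^2 + 30*x*v + 85*x^2 - 45*v^3 + 45*x*v^2 + 105*x^2*v + 135*x^3 - 90*x*v^3 + 150*x^2*v^2 + 90*x^3*v - 70*x^4) * JX x v
      + (-32 - 55*v - 5*x + 195*v^2 + 50*x*v - 5*x^2 + 165*v^3 + 135*x*v^2 + 15*x^2*v + 5*x^3 - 90*v^4 + 150*x*v^3 + 90*x^2*v^2 - 70*x^3*v) * JV x v := by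
  simp only [JJ, JX, JV]
  push_cast
  ring

lemma certB03 {R : Type*} [CommRing R] (x v : R) :
    ((19440 : ℤ) : R) * (x^0*v^3) =
      (((9720 : ℤ) : R) * (x^0*v^1) + ((11340 : ℤ) : R) * (x^0*v^2) + ((3240 : ℤ) : R) * (x^1*v^0) + ((-9720 : ℤ) : R) * (x^1*v^1) + ((-5940 : ℤ) : R) * (x^2*v^0) + ((2160 : ℤ) : R) * (x^3*v^0))
      + (-1620 - 4104*v - 216*x + 28944*v^2 - 6048*x*v + 4032*x^2 - 8532*v^3 - 2268*x*v^2 + 13716*x^2*v - 1476*x^3 - 78732*v^4 + 54432*x*v^3 - 36936*x^2*v^2 - 4320*x^3*v - 108*x^4 + 57024*v^5 - 77760*x*v^4 - 17280*x^2*v^3) * (JJ x v + 1)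
      + (-135 - 459*v + 585*x - 1431*v^2 + 2250*x*v + 297*x^2 + 4932*v^3 - 8262*x*v^2 + 600*x^2*v - 630*x^3 + 4482*v^4 - 2412*x*v^3 - 1512*x^2*v^2 - 2172*x^3*v + 126*x^4 - 7722*v^5 + 17334*x*v^4 - 7200*x^2*v^3 + 5832*x^3*v^2 + 666*x^4*v + 18*x^5 - 9504*x*v^5 + 12960*x^2*v^4 + 2880*x^3*v^3) * JX x v
      + (-135 + 1125*v + 153*x + 189*v^2 - 1602*x*v + 177*x^2 - 8802*v^3 + 3468*x*v^2 - 954*x^2*v - 176*x^3 + 3474*v^4 + 2880*x*v^3 - 4428*x^2*v^2 + 648*x^3*v + 34*x^4 + 14904*v^5 - 12276*x*v^4 + 8532*x^2*v^3 + 1188*x^3*v^2 + 36*x^4*v - 9504*v^6 + 12960*x*v^5 + 2880*x^2*v^4) * JV x v := by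
  simp only [JJ, JX, JV]
  push_cast
  ring

lemma certB12 {R : Type*} [CommRing R] (x v : R) :
    ((1080 : ℤ) : R) * (x^1*v^2) =
      (((-1080 : ℤ) : R) * (x^0*v^1) + ((-1620 : ℤ) : R) * (x^0*v^2) + ((360 : ℤ) : R) * (x^1*v^0) + ((-1080 : ℤ) : R) * (x^1*v^1) + ((540 : ℤ) : R) * (x^2*v^0) + ((-360 : ℤ) : R) * (x^3*v^0))
      + (360 - 216*v - 264*x - 6804*v^2 - 792*x*v - 612*x^2 + 4752*v^3 + 648*x*v^2 - 1296*x^2*v + 216*x^3 + 17712*v^4 + 6048*x*v^3 + 7776*x^2*v^2 + 1440*x^3*v + 48*x^4 - 5184*v^5 + 17280*x*v^4 + 8640*x^2*v^3) * (JJ x v + 1)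
      + (-15 + 39*v - 165*x + 351*v^2 - 180*x*v - 27*x^2 - 252*v^3 + 1962*x*v^2 + 240*x^2*v + 130*x^3 - 792*v^4 - 468*x*v^3 + 312*x^2*v^2 + 372*x^3*v - 16*x^4 + 432*v^5 - 3744*x*v^4 - 1080*x^2*v^3 - 1272*x^3*v^2 - 216*x^4*v - 8*x^5 + 864*x*v^5 - 2880*x^2*v^4 - 1440*x^3*v^3) * JX x v
      + (15 - 195*v - 43*x + 381*v^2 + 312*x*v + 3*x^2 + 1962*v^3 + 372*x*v^2 + 114*x^2*v + 16*x^3 - 1224*v^4 - 600*x*v^3 + 108*x^2*v^2 - 88*x^3*v - 4*x^4 - 3384*v^5 - 1224*x*v^4 - 1752*x^2*v^3 - 408*x^3*v^2 - 16*x^4*v + 864*v^6 - 2880*x*v^5 - 1440*x^2*v^4) * JV x v := by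
  simp only [JJ, JX, JV]
  push_cast
  ring

lemma certB21 {R : Type*} [CommRing R] (x v : R) :
    ((1296 : ℤ) : R) * (x^2*v^1) =
      (((-648 : ℤ) : R) * (x^0*v^1) + ((-324 : ℤ) : R) * (x^0*v^2) + ((648 : ℤ) : R) * (x^1*v^0) + ((-1944 : ℤ) : R) * (x^1*v^1) + ((540 : ℤ) : R) * (x^2*v^0) + ((-432 : ℤ) : R) * (x^3*v^0))
      + (324 - 648*v - 216*x - 6696*v^2 - 2160*x*v - 504*x^2 + 6372*v^3 - 324*x*v^2 - 1188*x^2*v + 36*x^3 + 16524*v^4 + 12960*x*v^3 + 5832*x^2*v^2 + 2592*x^3*v + 108*x^4 - 5184*v^5 + 15552*x*v^4 + 13824*x^2*v^3) * (JJ x v + 1)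
      + (-27 + 9*v - 171*x + 189*v^2 - 90*x*v - 63*x^2 - 144*v^3 + 1782*x*v^2 + 636*x^2*v + 126*x^3 - 378*v^4 - 900*x*v^3 + 432*x^2*v^2 + 492*x^3*v + 18*x^4 + 378*v^5 - 3078*x*v^4 - 2448*x^2*v^3 - 1080*x^3*v^2 - 378*x^4*v - 18*x^5 + 864*x*v^5 - 2592*x^2*v^4 - 2304*x^3*v^3) * JX x v
      + (9 - 171*v - 39*x + 549*v^2 + 234*x*v + 21*x^2 + 1890*v^3 + 840*x*v^2 + 18*x^2*v + 4*x^3 - 1602*v^4 - 360*x*v^3 - 36*x^2*v^2 - 2*x^4 - 3240*v^5 - 2556*x*v^4 - 1188*x^2*v^3 - 756*x^3*v^2 - 36*x^4*v + 864*v^6 - 2592*x*v^5 - 2304*x^2*v^4) * JV x v := by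
  simp only [JJ, JX, JV]
  push_cast
  ring

lemma certB31 {R : Type*} [CommRing R] (x v : R) :
    ((8640 : ℤ) : R) * (x^3*v^1) =
      (((1080 : ℤ) : R) * (x^0*v^1) + ((-1620 : ℤ) : R) * (x^0*v^2) + ((-1080 : ℤ) : R) * (x^1*v^0) + ((9720 : ℤ) : R) * (x^1*v^1) + ((540 : ℤ) : R) * (x^2*v^0))
      + (-936*v + 216*x + 756*v^2 - 3672*x*v - 252*x^2 - 648*v^3 + 648*x*v^2 - 216*x^2*v + 216*x^3 - 648*v^4 - 19872*x*v^3 + 1296*x^2*v^2 + 7200*x^3*v - 72*x^4 - 5184*v^5 - 8640*x^2*v^3) * (JJ x v + 1)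
      + (45 - 21*v - 45*x - 1134*v^2 + 330*x*v - 132*x^2 - 3132*v^3 - 1728*x*v^2 + 2340*x^2*v - 27*v^4 - 1548*x*v^3 - 918*x^2*v^2 + 852*x^3*v + 9*x^4 + 972*v^5 - 324*x*v^4 + 3240*x^2*v^3 - 72*x^3*v^2 - 1236*x^4*v + 12*x^5 + 864*x*v^5 + 1440*x^3*v^3) * JX x v
      + (-15 + 45*v - 23*x + 276*v^2 + 342*x*v - 2*x^2 + 432*v^3 - 1008*x*v^2 + 144*x^2*v + 56*x^3 + 621*v^4 + 360*x*v^3 - 1122*x^2*v^2 - 288*x^3*v - 19*x^4 + 216*v^5 + 4176*x*v^4 - 432*x^2*v^3 - 1008*x^3*v^2 + 24*x^4*v + 864*v^6 + 1440*x^2*v^4) * JV x v := by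
  simp only [JJ, JX, JV]
  push_cast
  ring

lemma certB40 {R : Type*} [CommRing R] (x v : R) :
    ((2880 : ℤ) : R) * (x^4*v^0) =
      (((7560 : ℤ) : R) * (x^0*v^1) + ((8100 : ℤ) : R) * (x^0*v^2) + ((-6120 : ℤ) : R) * (x^1*v^0) + ((7560 : ℤ) : R) * (x^1*v^1) + ((-2700 : ℤ) : R) * (x^2*v^0) + ((8640 : ℤ) : R) * (x^3*v^0))
      + (-2520 + 1512*v + 5448*x + 50868*v^2 + 5544*x*v + 3204*x^2 - 33264*v^3 + 3024*x*v^2 + 9072*x^2*v - 7632*x^3 - 123984*v^4 - 42336*x*v^3 - 54432*x^2*v^2 - 10080*x^3*v + 2544*x^4 + 36288*v^5 - 120960*x*v^4 - 60480*x^2*v^3) * (JJ x v + 1)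
      + (255 + 717*v + 1185*x - 1242*v^2 + 2070*x*v - 1716*x^2 + 684*v^3 - 14544*x*v^2 - 1140*x^2*v - 880*x^3 + 5679*v^4 + 2736*x*v^3 - 4614*x^2*v^2 - 2424*x^3*v + 1567*x^4 - 3024*v^5 + 26208*x*v^4 + 7560*x^2*v^3 + 8904*x^3*v^2 + 1512*x^4*v - 424*x^5 - 6048*x*v^5 + 20160*x^2*v^4 + 10080*x^3*v^3) * JX x v
      + (-105 + 1335*v + 271*x - 3072*v^2 - 1974*x*v - 66*x^2 - 14544*v^3 - 3144*x*v^2 + 192*x^2*v - 112*x^3 + 8703*v^4 + 3300*x*v^3 - 1026*x^2*v^2 + 916*x^3*v + 43*x^4 + 23688*v^5 + 8568*x*v^4 + 12264*x^2*v^3 + 2856*x^3*v^2 - 368*x^4*v - 6048*v^6 + 20160*x*v^5 + 10080*x^2*v^4) * JV x v := by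
  simp only [JJ, JX, JV]
  push_cast
  ring

lemma O1_JJ (t s : ℝ) (ht : t^3 = 3*t - 1) (hs : s^2 = 3) :
    JJ ((1/2)*t) (-(2/3) + (1/6)*t + (1/3)*t^2) = 0 := by
  simp only [JJ]
  linear_combination ((37/27) + (5/9)*t - (101/9)*t^2 - (86/9)*t^3 + (94/9)*t^4 + (77/9)*t^5 - (17/9)*t^6 - (19/9)*t^7 - (2/9)*t^8 + (1/27)*t^9) * ht + (0) * hs

lemma O1_JX (t s : ℝ) (ht : t^3 = 3*t - 1) (hs : s^2 = 3) :
    JX ((1/2)*t) (-(2/3) + (1/6)*t + (1/3)*t^2) = 0 := by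
  simp only [JX]
  linear_combination ((16/3) - (28/3)*t - (106/3)*t^2 + 4*t^3 + 24*t^4 + (8/3)*t^5 - (10/3)*t^6 - (2/3)*t^7) * ht + (0) * hs

lemma O1_JV (t s : ℝ) (ht : t^3 = 3*t - 1) (hs : s^2 = 3) :
    JV ((1/2)*t) (-(2/3) + (1/6)*t + (1/3)*t^2) = 0 := by
  simp only [JV]
  linear_combination (-(112/3) - (124/3)*t + 74*t^2 + (220/3)*t^3 - (68/3)*t^4 - 28*t^5 - (10/3)*t^6 + (2/3)*t^7) * ht + (0) * hs

lemma O2_JJ (t s : ℝ) (ht : t^3 = 3*t - 1) (hs : s^2 = 3) :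
    JJ (-s + (1/2)*t + (1/2)*t*s + (1/2)*t^2*s) (-(2/3) - (1/3)*s + (1/6)*t - (1/6)*t*s + (1/3)*t^2 + (1/6)*t^2*s) = 0 := by
  simp only [JJ]
  linear_combination ((1189/27) + (224/9)*s + (77/9)*t + (8/3)*t*s - (4997/9)*t^2 - (904/3)*t^2*s + (2596/9)*t^3 + (442/3)*t^3*s + (5908/9)*t^4 + (1072/3)*t^4*s - (2155/9)*t^5 - (350/3)*t^5*s - (2555/9)*t^6 - 152*t^6*s + (377/9)*t^7 + (56/3)*t^7*s + (394/9)*t^8 + (68/3)*t^8*s + (73/27)*t^9 + (14/9)*t^9*s) * ht + ((128/9) + (160/27)*s - 40*t + (16/3)*s^2 - (248/9)*t*s - (568/3)*t^2 + (64/9)*s^3 - (112/3)*t*s^2 - (668/9)*t^2*s + (5918/9)*t^3 + (64/27)*s^4 - 92*t^2*s^2 + (10504/27)*t^3*s - 80*t^4 + (64/9)*t*s^4 - (320/3)*t^2*s^3 + (1028/3)*t^3*s^2 - (292/3)*t^4*s - 910*t^5 - (224/9)*t^2*s^4 + (880/9)*t^3*s^3 + 39*t^4*s^2 - 544*t^5*s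 + (760/3)*t^6 - (320/27)*t^3*s^4 + 180*t^4*s^3 - 472*t^5*s^2 + (1520/9)*t^6*s + 512*t^7 + (140/3)*t^4*s^4 - 158*t^5*s^3 + 23*t^6*s^2 + 308*t^7*s - 112*t^8 + 8*t^5*s^4 - (382/3)*t^6*s^3 + 260*t^7*s^2 - (196/3)*t^8*s - (1234/9)*t^9 - (313/9)*t^6*s^4 + 88*t^7*s^3 - 8*t^8*s^2 - (2204/27)*t^9*s + 12*t^10 - 4*t^7*s^4 + 46*t^8*s^3 - (194/3)*t^9*s^2 + (52/9)*t^10*s + (44/3)*t^11 + (35/3)*t^8*s^4 - (176/9)*t^9*s^3 - (7/3)*t^10*s^2 + (76/9)*t^11*s + (8/9)*t^12 + (40/27)*t^9*s^4 - 8*t^10*s^3 + 6*t^11*s^2 + (16/27)*t^12*s - (14/9)*t^10*s^4 + (4/3)*t^11*s^3 + (2/3)*t^12*s^2 - (2/9)*t^11*s^4 + (4/9)*t^12*s^3 + (1/27)*t^12*s^4) * hs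

lemma O2_JX (t s : ℝ) (ht : t^3 = 3*t - 1) (hs : s^2 = 3) :
    JX (-s + (1/2)*t + (1/2)*t*s + (1/2)*t^2*s) (-(2/3) - (1/3)*s + (1/6)*t - (1/6)*t*s + (1/3)*t^2 + (1/6)*t^2*s) = 0 := by
  simp only [JX]
  linear_combination (-(344/3) - (184/3)*s - (1996/3)*t - 372*t*s + (2564/3)*t^2 + (1580/3)*t^2*s + 710*t^3 + (1058/3)*t^3*s - 590*t^4 - (1144/3)*t^4*s - (760/3)*t^5 - (358/3)*t^5*s + (290/3)*t^6 + 70*t^6*s + (88/3)*t^7 + (50/3)*t^7*s) * ht + (-40 - (112/3)*s - (296/3)*t - (32/3)*s^2 - (176/3)*t*s + (2858/3)*t^2 - 128*t*s^2 + (2032/3)*t^2*s - (2084/3)*t^3 - (160/3)*t*s^3 + (1168/3)*t^2*s^2 - (1426/3)*t^3*s - (3388/3)*t^4 + (160/3)*t^2*s^3 + (176/3)*t^3*s^2 - (2396/3)*t^4*s + (2476/3)*t^5 + (320/3)*t^3*s^3 - (1724/3)*t^4*s^2 + (1706/3)*t^5*s + (1574/3)*t^6 - (260/3)*t^4*s^3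 + (122/3)*t^5*s^2 + (1096/3)*t^6*s - (884/3)*t^7 - (238/3)*t^5*s^3 + (892/3)*t^6*s^2 - (616/3)*t^7*s - (346/3)*t^8 + (130/3)*t^6*s^3 - (52/3)*t^7*s^2 - (236/3)*t^8*s + (100/3)*t^9 + (80/3)*t^7*s^3 - (182/3)*t^8*s^2 + (70/3)*t^9*s + 10*t^10 - (20/3)*t^8*s^3 + (20/3)*t^10*s - (10/3)*t^9*s^3 + (10/3)*t^10*s^2) * hs

lemma O2_JV (t s : ℝ) (ht : t^3 = 3*t - 1) (hs : s^2 = 3) :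
    JV (-s + (1/2)*t + (1/2)*t*s + (1/2)*t^2*s) (-(2/3) - (1/3)*s + (1/6)*t - (1/6)*t*s + (1/3)*t^2 + (1/6)*t^2*s) = 0 := by
  simp only [JV]
  linear_combination (-(664/3) - (376/3)*s + (2852/3)*t + (2060/3)*t*s + 752*t^2 + 300*t^2*s - (4430/3)*t^3 - (2966/3)*t^3*s - (2090/3)*t^4 - (908/3)*t^4*s + 488*t^5 + 330*t^5*s + (590/3)*t^6 + (290/3)*t^6*s - (28/3)*t^7 - (34/3)*t^7*s) * ht + (-(184/3) + (16/3)*s + (1544/3)*t - (224/3)*s^2 + (1312/3)*t*s - 766*t^2 - (128/3)*s^3 + (1216/3)*t*s^2 - 840*t^2*s - 1256*t^3 + (160/3)*t*s^3 - 16*t^2*s^2 - 906*t^3*s + 1656*t^4 + 160*t^2*s^3 - 1040*t^3*s^2 + 1424*t^4*s + 1072*t^5 - 160*t^3*s^3 + 208*t^4*s^2 + 738*t^5*s - 966*t^6 - 180*t^4*s^3 + 850*t^5*s^2 - 748*t^6*s - 428*t^7 + 134*t^5*s^3 - 104*t^6*s^2 - 288*t^7*s + 182*t^8 + 90*t^6*s^3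 - 284*t^7*s^2 + 132*t^8*s + (200/3)*t^9 - 40*t^7*s^3 + 2*t^8*s^2 + (130/3)*t^9*s - (10/3)*t^10 - 20*t^8*s^3 + (100/3)*t^9*s^2 - (8/3)*t^10*s + (10/3)*t^9*s^3 + (10/3)*t^10*s^2 + (4/3)*t^10*s^3) * hs

lemma O3_JJ (t s : ℝ) (ht : t^3 = 3*t - 1) (hs : s^2 = 3) :
    JJ (-(1/3)*s - (1/2)*t - (1/6)*t*s + (1/6)*t^2*s) ((2/3) + (1/3)*s - (1/6)*t - (1/6)*t*s - (1/3)*t^2 - (1/6)*t^2*s) = 0 := by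
  simp only [JJ]
  linear_combination (-(67/3) - (352/27)*s + (335/3)*t + (584/9)*t*s - 117*t^2 - (608/9)*t^2*s - (352/3)*t^3 - (610/9)*t^3*s + (508/3)*t^4 + (880/9)*t^4*s + 49*t^5 + (254/9)*t^5*s - (217/3)*t^6 - (376/9)*t^6*s - (37/3)*t^7 - (64/9)*t^7*s + 10*t^8 + (52/9)*t^8*s + (5/3)*t^9 + (26/27)*t^9*s) * ht + (-(640/81) + (128/81)*s + (1304/27)*t + (1040/243)*s^2 + (56/9)*t*s - (3880/27)*t^2 + (64/81)*s^3 - (784/81)*t*s^2 - (1748/27)*t^2*s + (7898/81)*t^3 - (64/729)*s^4 - (320/81)*t*s^3 - (1084/81)*t^2*s^2 + (7316/81)*t^3*s + (1792/9)*t^4 - (64/243)*t*s^4 + (64/27)*t^2*s^3 + (12260/243)*t^3*s^2 + (208/3)*t^4*s - (646/3)*t^5 + (224/243)*t^2*s^4 + (304/27)*t^3*s^3 - (59/27)*t^4*s^2 - (1292/9)*t^5*s - (2828/27)*t^6 + (320/729)*t^3*s^4 - (28/3)*t^4*s^3 - (556/9)*t^5*s^2 - (752/27)*t^6*s + (400/3)*t^7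 - (140/81)*t^4*s^4 - (34/3)*t^5*s^3 + (883/81)*t^6*s^2 + (244/3)*t^7*s + (268/9)*t^8 - (8/27)*t^5*s^4 + (226/27)*t^6*s^3 + (292/9)*t^7*s^2 + (64/9)*t^8*s - (2830/81)*t^9 + (313/243)*t^6*s^4 + (152/27)*t^7*s^3 - (116/27)*t^8*s^2 - (1648/81)*t^9*s - (148/27)*t^10 + (4/27)*t^7*s^4 - (26/9)*t^8*s^3 - (1942/243)*t^9*s^2 - (16/9)*t^10*s + (92/27)*t^11 - (35/81)*t^8*s^4 - (116/81)*t^9*s^3 + (23/81)*t^10*s^2 + (52/27)*t^11*s + (44/81)*t^12 - (40/729)*t^9*s^4 + (28/81)*t^10*s^3 + (62/81)*t^11*s^2 + (20/81)*t^12*s + (14/243)*t^10*s^4 + (4/27)*t^11*s^3 + (14/243)*t^12*s^2 + (2/243)*t^11*s^4 - (1/729)*t^12*s^4) * hs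

lemma O3_JX (t s : ℝ) (ht : t^3 = 3*t - 1) (hs : s^2 = 3) :
    JX (-(1/3)*s - (1/2)*t - (1/6)*t*s + (1/6)*t^2*s) ((2/3) + (1/3)*s - (1/6)*t - (1/6)*t*s - (1/3)*t^2 - (1/6)*t^2*s) = 0 := by
  simp only [JX]
  linear_combination (-(472/3) - (824/9)*s + (844/3)*t + (1468/9)*t*s + 252*t^2 + (436/3)*t^2*s - (1034/3)*t^3 - (1786/9)*t^3*s - (502/3)*t^4 - (868/9)*t^4*s + 96*t^5 + (166/3)*t^5*s + (110/3)*t^6 + (190/9)*t^6*s - (8/3)*t^7 - (14/9)*t^7*s) * ht + (-40 - (80/9)*s + 216*t + (32/9)*s^2 + (608/9)*t*s - (2002/9)*t^2 + (128/81)*s^3 + (128/27)*t*s^2 - (1160/9)*t^2*s - (3212/9)*t^3 - (160/81)*t*s^3 - (400/9)*t^2*s^2 - (778/9)*t^3*s + (3680/9)*t^4 - (160/27)*t^2*s^3 + (80/9)*t^3*s^2 + (1952/9)*t^4*s + (2188/9)*t^5 + (160/27)*t^3*s^3 + (572/9)*t^4*s^2 + (458/9)*t^5*s - (1906/9)*t^6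 + (20/3)*t^4*s^3 - (110/9)*t^5*s^2 - (1028/9)*t^6*s - (740/9)*t^7 - (134/27)*t^5*s^3 - (100/3)*t^6*s^2 - (176/9)*t^7*s + (338/9)*t^8 - (10/3)*t^6*s^3 + (28/9)*t^7*s^2 + (196/9)*t^8*s + (100/9)*t^9 + (40/27)*t^7*s^3 + (62/9)*t^8*s^2 + (10/3)*t^9*s - (10/9)*t^10 + (20/27)*t^8*s^3 - (8/9)*t^10*s - (10/81)*t^9*s^3 - (10/27)*t^10*s^2 - (4/81)*t^10*s^3) * hs

lemma O3_JV (t s : ℝ) (ht : t^3 = 3*t - 1) (hs : s^2 = 3) :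
    JV (-(1/3)*s - (1/2)*t - (1/6)*t*s + (1/6)*t^2*s) ((2/3) + (1/3)*s - (1/6)*t - (1/6)*t*s - (1/3)*t^2 - (1/6)*t^2*s) = 0 := by
  simp only [JV]
  linear_combination (-(376/3) - (200/3)*s + (1340/3)*t + 260*t*s - 272*t^2 - 156*t^2*s - (1250/3)*t^3 - (718/3)*t^3*s + (874/3)*t^4 + 168*t^4*s + 136*t^5 + 78*t^5*s - (190/3)*t^6 - (110/3)*t^6*s - (52/3)*t^7 - 10*t^7*s) * ht + (-(104/9) + (368/9)*s + (1576/9)*t + (416/27)*s^2 - (112/3)*t*s - (1658/3)*t^2 - (1216/27)*t*s^2 - (2096/9)*t^2*s + (752/3)*t^3 - (160/27)*t*s^3 - (208/9)*t^2*s^2 + (2642/9)*t^3*s + (1940/3)*t^4 + (160/27)*t^2*s^3 + (1072/9)*t^3*s^2 + (1900/9)*t^4*s - (1264/3)*t^5 + (320/27)*t^3*s^3 - (16/9)*t^4*s^2 - (2626/9)*t^5*s - 282*t^6 - (260/27)*t^4*s^3 - (866/9)*t^5*s^2 - (752/9)*t^6*s + 172*t^7 - (238/27)*t^5*s^3 +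 (16/3)*t^6*s^2 + (920/9)*t^7*s + (178/3)*t^8 + (130/27)*t^6*s^3 + (284/9)*t^7*s^2 + (172/9)*t^8*s - (200/9)*t^9 + (80/27)*t^7*s^3 + (2/9)*t^8*s^2 - (110/9)*t^9*s - (50/9)*t^10 - (20/27)*t^8*s^3 - (100/27)*t^9*s^2 - (20/9)*t^10*s - (10/27)*t^9*s^3 - (10/27)*t^10*s^2) * hs

lemma O4_JJ (t s : ℝ) (ht : t^3 = 3*t - 1) (hs : s^2 = 3) :
    JJ (-(1/2)*t) (-(2/3) + (1/6)*t + (1/3)*t^2) = -1 := by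
  simp only [JJ]
  linear_combination ((64/27) - (16/9)*t - (140/9)*t^2 - (20/9)*t^3 + (133/9)*t^4 + (17/9)*t^5 - (41/9)*t^6 - (4/9)*t^7 + (4/9)*t^8 + (1/27)*t^9) * ht + (0) * hs

lemma O4_JX (t s : ℝ) (ht : t^3 = 3*t - 1) (hs : s^2 = 3) :
    JX (-(1/2)*t) (-(2/3) + (1/6)*t + (1/3)*t^2) = 0 := by
  simp only [JX]
  linear_combination ((16/3) + 36*t - (2/3)*t^2 - (104/3)*t^3 - (2/3)*t^4 + (28/3)*t^5 - (2/3)*t^7) * ht + (0) * hs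

lemma O4_JV (t s : ℝ) (ht : t^3 = 3*t - 1) (hs : s^2 = 3) :
    JV (-(1/2)*t) (-(2/3) + (1/6)*t + (1/3)*t^2) = 0 := by
  simp only [JV]
  linear_combination (-(112/3) - (76/3)*t + 94*t^2 + (88/3)*t^3 - (146/3)*t^4 - 8*t^5 + (20/3)*t^6 + (2/3)*t^7) * ht + (0) * hs

/-- Which of the 22 points lie on `JJ = 0` (the others lie on `JJ = -1`). -/
def fl : Fin 22 → Bool := ![true, false, true, true, false, true, true, true, false, false, true, true, true, true, true, false, false, true, true, false, true, true]

/-- A critical point of `JJ` of critical value `e`. -/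
def Crit (e a b : ℝ) : Prop := JJ a b = e ∧ JX a b = 0 ∧ JV a b = 0

lemma exists_root : ∃ t : ℝ, t^3 = 3*t - 1 ∧ 1.532 < t ∧ t < 1.5321 := by
  have hc : ContinuousOn (fun t : ℝ => t^3 - 3*t) (Set.Icc 1.532 1.5321) := by fun_prop
  have h := intermediate_value_Ioo (by norm_num : (1.532 : ℝ) ≤ 1.5321) hc
  have hm : (-1 : ℝ) ∈ Set.Ioo ((1.532 : ℝ)^3 - 3*1.532) ((1.5321 : ℝ)^3 - 3*1.5321) := by
    constructor <;> norm_num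
  obtain ⟨t, ht, he⟩ := h hm
  exact ⟨t, by simp only at he; linarith, ht.1, ht.2⟩

lemma rat11 : Crit (-1) (0) (0) := by
  refine ⟨?_, ?_, ?_⟩ <;> norm_num [JJ, JX, JV]

lemma rat00 : Crit (-1) (-1) (-1) := by
  refine ⟨?_, ?_, ?_⟩ <;> norm_num [JJ, JX, JV]

lemma rat02 : Crit (-1) (-1) (1) := by
  refine ⟨?_, ?_, ?_⟩ <;> norm_num [JJ, JX, JV]

lemma rat31 : Crit (-1) (2) (0) := by
  refine ⟨?_, ?_, ?_⟩ <;> norm_num [JJ, JX, JV]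

set_option maxHeartbeats 4000000 in
lemma exists_points : ∃ a b : Fin 22 → ℝ,
    (∀ i, Crit (cond (fl i) 0 (-1)) (a i) (b i)) ∧ StrictMono (fun i => a i + 29 * b i) := by
  obtain ⟨t, ht, hl, hu⟩ := exists_root
  obtain ⟨t₂, h2⟩ : ∃ t₂ : ℝ, t₂ = t^2 - 2 := ⟨_, rfl⟩
  obtain ⟨t₃, h3⟩ : ∃ t₃ : ℝ, t₃ = 2 - t - t^2 := ⟨_, rfl⟩
  obtain ⟨s, hs, hsl, hsu⟩ : ∃ s : ℝ, s^2 = 3 ∧ 1.73205 < s ∧ s < 1.73206 := by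
    refine ⟨√3, Real.sq_sqrt (by norm_num), ?_, ?_⟩
    · exact Real.lt_sqrt_of_sq_lt (by norm_num)
    · rw [Real.sqrt_lt' (by norm_num)]; norm_num
  have hs' : (-s)^2 = 3 := by rw [neg_sq, hs]
  have ht₂ : t₂^3 = 3*t₂ - 1 := by
    rw [h2]; linear_combination (t^3 - 3*t - 1) * ht
  have ht₃ : t₃^3 = 3*t₃ - 1 := by
    rw [h3]; linear_combination (-t^3 - 3*t^2 + 3) * ht
  have q2 : t₂^2 = -t^2 - t + 4 := by rw [h2]; linear_combination t * ht
  have q3 : t₃^2 = t + 2 := by rw [h3]; linear_combination (t + 2) * ht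
  have b1 : 2.34702 < t^2 := by nlinarith
  have b2 : t^2 < 2.34734 := by nlinarith
  have c1 : 1.73205 * 1.532 < s * t := by nlinarith
  have c2 : s * t < 1.73206 * 1.5321 := by nlinarith
  have d1 : 1.73205 * 2.34702 < s * t^2 := by nlinarith
  have d2 : s * t^2 < 1.73206 * 2.34734 := by nlinarith
  have m1 : s * t₂ = s * t^2 - 2 * s := by rw [h2]; ring
  have m2 : s * t₃ = 2 * s - s * t - s * t^2 := by rw [h3]; ring
  have m3 : s * t₂^2 = -(s * t^2) - s * t + 4 * s := by rw [q2]; ring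
  have m4 : s * t₃^2 = s * t + 2 * s := by rw [q3]; ring
  refine ⟨![-s + (1/2)*t₂ + (1/2)*t₂*s + (1/2)*t₂^2*s,
      -1,
      -(1/3)*s - (1/2)*t - (1/6)*t*s + (1/6)*t^2*s,
      -(-s) + (1/2)*t₃ + (1/2)*t₃*(-s) + (1/2)*t₃^2*(-s),
      -(1/2)*t₂,
      (1/2)*t₂,
      -(1/3)*(-s) - (1/2)*t₃ - (1/6)*t₃*(-s) + (1/6)*t₃^2*(-s),
      -(1/3)*s - (1/2)*t₃ - (1/6)*t₃*s + (1/6)*t₃^2*s,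
      0,
      2,
      -s + (1/2)*t + (1/2)*t*s + (1/2)*t^2*s,
      -(-s) + (1/2)*t₂ + (1/2)*t₂*(-s) + (1/2)*t₂^2*(-s),
      -(1/3)*(-s) - (1/2)*t₂ - (1/6)*t₂*(-s) + (1/6)*t₂^2*(-s),
      -(1/3)*(-s) - (1/2)*t - (1/6)*t*(-s) + (1/6)*t^2*(-s),
      (1/2)*t₃,
      -(1/2)*t₃,
      -(1/2)*t,
      (1/2)*t,
      -(-s) + (1/2)*t + (1/2)*t*(-s) + (1/2)*t^2*(-s),
      -1,
      -(1/3)*s - (1/2)*t₂ - (1/6)*t₂*s + (1/6)*t₂^2*s,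
      -s + (1/2)*t₃ + (1/2)*t₃*s + (1/2)*t₃^2*s], ![-(2/3) - (1/3)*s + (1/6)*t₂ - (1/6)*t₂*s + (1/3)*t₂^2 + (1/6)*t₂^2*s,
      -1,
      (2/3) + (1/3)*s - (1/6)*t - (1/6)*t*s - (1/3)*t^2 - (1/6)*t^2*s,
      -(2/3) - (1/3)*(-s) + (1/6)*t₃ - (1/6)*t₃*(-s) + (1/3)*t₃^2 + (1/6)*t₃^2*(-s),
      -(2/3) + (1/6)*t₂ + (1/3)*t₂^2,
      -(2/3) + (1/6)*t₂ + (1/3)*t₂^2,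
      (2/3) + (1/3)*(-s) - (1/6)*t₃ - (1/6)*t₃*(-s) - (1/3)*t₃^2 - (1/6)*t₃^2*(-s),
      (2/3) + (1/3)*s - (1/6)*t₃ - (1/6)*t₃*s - (1/3)*t₃^2 - (1/6)*t₃^2*s,
      0,
      0,
      -(2/3) - (1/3)*s + (1/6)*t - (1/6)*t*s + (1/3)*t^2 + (1/6)*t^2*s,
      -(2/3) - (1/3)*(-s) + (1/6)*t₂ - (1/6)*t₂*(-s) + (1/3)*t₂^2 + (1/6)*t₂^2*(-s),
      (2/3) + (1/3)*(-s) - (1/6)*t₂ - (1/6)*t₂*(-s) - (1/3)*t₂^2 - (1/6)*t₂^2*(-s),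
      (2/3) + (1/3)*(-s) - (1/6)*t - (1/6)*t*(-s) - (1/3)*t^2 - (1/6)*t^2*(-s),
      -(2/3) + (1/6)*t₃ + (1/3)*t₃^2,
      -(2/3) + (1/6)*t₃ + (1/3)*t₃^2,
      -(2/3) + (1/6)*t + (1/3)*t^2,
      -(2/3) + (1/6)*t + (1/3)*t^2,
      -(2/3) - (1/3)*(-s) + (1/6)*t - (1/6)*t*(-s) + (1/3)*t^2 + (1/6)*t^2*(-s),
      1,
      (2/3) + (1/3)*s - (1/6)*t₂ - (1/6)*t₂*s - (1/3)*t₂^2 - (1/6)*t₂^2*s,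
      -(2/3) - (1/3)*s + (1/6)*t₃ - (1/6)*t₃*s + (1/3)*t₃^2 + (1/6)*t₃^2*s], ?_, ?_⟩
  · intro i
    fin_cases i
    · exact ⟨O2_JJ t₂ s ht₂ hs, O2_JX t₂ s ht₂ hs, O2_JV t₂ s ht₂ hs⟩
    · exact rat00
    · exact ⟨O3_JJ t s ht hs, O3_JX t s ht hs, O3_JV t s ht hs⟩
    · exact ⟨O2_JJ t₃ (-s) ht₃ hs', O2_JX t₃ (-s) ht₃ hs', O2_JV t₃ (-s) ht₃ hs'⟩
    · exact ⟨O4_JJ t₂ s ht₂ hs, O4_JX t₂ s ht₂ hs, O4_JV t₂ s ht₂ hs⟩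
    · exact ⟨O1_JJ t₂ s ht₂ hs, O1_JX t₂ s ht₂ hs, O1_JV t₂ s ht₂ hs⟩
    · exact ⟨O3_JJ t₃ (-s) ht₃ hs', O3_JX t₃ (-s) ht₃ hs', O3_JV t₃ (-s) ht₃ hs'⟩
    · exact ⟨O3_JJ t₃ s ht₃ hs, O3_JX t₃ s ht₃ hs, O3_JV t₃ s ht₃ hs⟩
    · exact rat11
    · exact rat31
    · exact ⟨O2_JJ t s ht hs, O2_JX t s ht hs, O2_JV t s ht hs⟩
    · exact ⟨O2_JJ t₂ (-s) ht₂ hs', O2_JX t₂ (-s) ht₂ hs', O2_JV t₂ (-s) ht₂ hs'⟩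
    · exact ⟨O3_JJ t₂ (-s) ht₂ hs', O3_JX t₂ (-s) ht₂ hs', O3_JV t₂ (-s) ht₂ hs'⟩
    · exact ⟨O3_JJ t (-s) ht hs', O3_JX t (-s) ht hs', O3_JV t (-s) ht hs'⟩
    · exact ⟨O1_JJ t₃ s ht₃ hs, O1_JX t₃ s ht₃ hs, O1_JV t₃ s ht₃ hs⟩
    · exact ⟨O4_JJ t₃ s ht₃ hs, O4_JX t₃ s ht₃ hs, O4_JV t₃ s ht₃ hs⟩
    · exact ⟨O4_JJ t s ht hs, O4_JX t s ht hs, O4_JV t s ht hs⟩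
    · exact ⟨O1_JJ t s ht hs, O1_JX t s ht hs, O1_JV t s ht hs⟩
    · exact ⟨O2_JJ t (-s) ht hs', O2_JX t (-s) ht hs', O2_JV t (-s) ht hs'⟩
    · exact rat02
    · exact ⟨O3_JJ t₂ s ht₂ hs, O3_JX t₂ s ht₂ hs, O3_JV t₂ s ht₂ hs⟩
    · exact ⟨O2_JJ t₃ s ht₃ hs, O2_JX t₃ s ht₃ hs, O2_JV t₃ s ht₃ hs⟩
  · rw [Fin.strictMono_iff_lt_succ]
    intro i
    fin_cases i
    · show -s + (1/2)*t₂ + (1/2)*t₂*s + (1/2)*t₂^2*s + 29 * (-(2/3) - (1/3)*s + (1/6)*t₂ - (1/6)*t₂*s + (1/3)*t₂^2 + (1/6)*t₂^2*s) < -1 + 29 * (-1)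
      linarith
    · show -1 + 29 * (-1) < -(1/3)*s - (1/2)*t - (1/6)*t*s + (1/6)*t^2*s + 29 * ((2/3) + (1/3)*s - (1/6)*t - (1/6)*t*s - (1/3)*t^2 - (1/6)*t^2*s)
      linarith
    · show -(1/3)*s - (1/2)*t - (1/6)*t*s + (1/6)*t^2*s + 29 * ((2/3) + (1/3)*s - (1/6)*t - (1/6)*t*s - (1/3)*t^2 - (1/6)*t^2*s) < -(-s) + (1/2)*t₃ + (1/2)*t₃*(-s) + (1/2)*t₃^2*(-s) + 29 * (-(2/3) - (1/3)*(-s) + (1/6)*t₃ - (1/6)*t₃*(-s) + (1/3)*t₃^2 + (1/6)*t₃^2*(-s))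
      linarith
    · show -(-s) + (1/2)*t₃ + (1/2)*t₃*(-s) + (1/2)*t₃^2*(-s) + 29 * (-(2/3) - (1/3)*(-s) + (1/6)*t₃ - (1/6)*t₃*(-s) + (1/3)*t₃^2 + (1/6)*t₃^2*(-s)) < -(1/2)*t₂ + 29 * (-(2/3) + (1/6)*t₂ + (1/3)*t₂^2)
      linarith
    · show -(1/2)*t₂ + 29 * (-(2/3) + (1/6)*t₂ + (1/3)*t₂^2) < (1/2)*t₂ + 29 * (-(2/3) + (1/6)*t₂ + (1/3)*t₂^2)
      linarith
    · show (1/2)*t₂ + 29 * (-(2/3) + (1/6)*t₂ + (1/3)*t₂^2) < -(1/3)*(-s) - (1/2)*t₃ - (1/6)*t₃*(-s) + (1/6)*t₃^2*(-s) + 29 * ((2/3) + (1/3)*(-s) - (1/6)*t₃ - (1/6)*t₃*(-s) - (1/3)*t₃^2 - (1/6)*t₃^2*(-s))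
      linarith
    · show -(1/3)*(-s) - (1/2)*t₃ - (1/6)*t₃*(-s) + (1/6)*t₃^2*(-s) + 29 * ((2/3) + (1/3)*(-s) - (1/6)*t₃ - (1/6)*t₃*(-s) - (1/3)*t₃^2 - (1/6)*t₃^2*(-s)) < -(1/3)*s - (1/2)*t₃ - (1/6)*t₃*s + (1/6)*t₃^2*s + 29 * ((2/3) + (1/3)*s - (1/6)*t₃ - (1/6)*t₃*s - (1/3)*t₃^2 - (1/6)*t₃^2*s)
      linarith
    · show -(1/3)*s - (1/2)*t₃ - (1/6)*t₃*s + (1/6)*t₃^2*s + 29 * ((2/3) + (1/3)*s - (1/6)*t₃ - (1/6)*t₃*s - (1/3)*t₃^2 - (1/6)*t₃^2*s) < 0 + 29 * (0)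
      linarith
    · show 0 + 29 * (0) < 2 + 29 * (0)
      linarith
    · show 2 + 29 * (0) < -s + (1/2)*t + (1/2)*t*s + (1/2)*t^2*s + 29 * (-(2/3) - (1/3)*s + (1/6)*t - (1/6)*t*s + (1/3)*t^2 + (1/6)*t^2*s)
      linarith
    · show -s + (1/2)*t + (1/2)*t*s + (1/2)*t^2*s + 29 * (-(2/3) - (1/3)*s + (1/6)*t - (1/6)*t*s + (1/3)*t^2 + (1/6)*t^2*s) < -(-s) + (1/2)*t₂ + (1/2)*t₂*(-s) + (1/2)*t₂^2*(-s) + 29 * (-(2/3) - (1/3)*(-s) + (1/6)*t₂ - (1/6)*t₂*(-s) + (1/3)*t₂^2 + (1/6)*t₂^2*(-s))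
      linarith
    · show -(-s) + (1/2)*t₂ + (1/2)*t₂*(-s) + (1/2)*t₂^2*(-s) + 29 * (-(2/3) - (1/3)*(-s) + (1/6)*t₂ - (1/6)*t₂*(-s) + (1/3)*t₂^2 + (1/6)*t₂^2*(-s)) < -(1/3)*(-s) - (1/2)*t₂ - (1/6)*t₂*(-s) + (1/6)*t₂^2*(-s) + 29 * ((2/3) + (1/3)*(-s) - (1/6)*t₂ - (1/6)*t₂*(-s) - (1/3)*t₂^2 - (1/6)*t₂^2*(-s))
      linarith
    · show -(1/3)*(-s) - (1/2)*t₂ - (1/6)*t₂*(-s) + (1/6)*t₂^2*(-s) + 29 * ((2/3) + (1/3)*(-s) - (1/6)*t₂ - (1/6)*t₂*(-s) - (1/3)*t₂^2 - (1/6)*t₂^2*(-s)) < -(1/3)*(-s) - (1/2)*t - (1/6)*t*(-s) + (1/6)*t^2*(-s) + 29 * ((2/3) + (1/3)*(-s) - (1/6)*t - (1/6)*t*(-s) - (1/3)*t^2 - (1/6)*t^2*(-s))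
      linarith
    · show -(1/3)*(-s) - (1/2)*t - (1/6)*t*(-s) + (1/6)*t^2*(-s) + 29 * ((2/3) + (1/3)*(-s) - (1/6)*t - (1/6)*t*(-s) - (1/3)*t^2 - (1/6)*t^2*(-s)) < (1/2)*t₃ + 29 * (-(2/3) + (1/6)*t₃ + (1/3)*t₃^2)
      linarith
    · show (1/2)*t₃ + 29 * (-(2/3) + (1/6)*t₃ + (1/3)*t₃^2) < -(1/2)*t₃ + 29 * (-(2/3) + (1/6)*t₃ + (1/3)*t₃^2)
      linarith
    · show -(1/2)*t₃ + 29 * (-(2/3) + (1/6)*t₃ + (1/3)*t₃^2) < -(1/2)*t + 29 * (-(2/3) + (1/6)*t + (1/3)*t^2)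
      linarith
    · show -(1/2)*t + 29 * (-(2/3) + (1/6)*t + (1/3)*t^2) < (1/2)*t + 29 * (-(2/3) + (1/6)*t + (1/3)*t^2)
      linarith
    · show (1/2)*t + 29 * (-(2/3) + (1/6)*t + (1/3)*t^2) < -(-s) + (1/2)*t + (1/2)*t*(-s) + (1/2)*t^2*(-s) + 29 * (-(2/3) - (1/3)*(-s) + (1/6)*t - (1/6)*t*(-s) + (1/3)*t^2 + (1/6)*t^2*(-s))
      linarith
    · show -(-s) + (1/2)*t + (1/2)*t*(-s) + (1/2)*t^2*(-s) + 29 * (-(2/3) - (1/3)*(-s) + (1/6)*t - (1/6)*t*(-s) + (1/3)*t^2 + (1/6)*t^2*(-s)) < -1 + 29 * (1)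
      linarith
    · show -1 + 29 * (1) < -(1/3)*s - (1/2)*t₂ - (1/6)*t₂*s + (1/6)*t₂^2*s + 29 * ((2/3) + (1/3)*s - (1/6)*t₂ - (1/6)*t₂*s - (1/3)*t₂^2 - (1/6)*t₂^2*s)
      linarith
    · show -(1/3)*s - (1/2)*t₂ - (1/6)*t₂*s + (1/6)*t₂^2*s + 29 * ((2/3) + (1/3)*s - (1/6)*t₂ - (1/6)*t₂*s - (1/3)*t₂^2 - (1/6)*t₂^2*s) < -s + (1/2)*t₃ + (1/2)*t₃*s + (1/2)*t₃^2*s + 29 * (-(2/3) - (1/3)*s + (1/6)*t₃ - (1/6)*t₃*s + (1/3)*t₃^2 + (1/6)*t₃^2*s)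
      linarith

section Main

open MvPolynomial

/-- The three-variable polynomial ring. -/
abbrev R3 := MvPolynomial (Fin 3) ℂ

/-- The complex number `√3`. -/
def s3 : ℂ := ((Real.sqrt 3 : ℝ) : ℂ)

lemma s3_sq : s3 ^ 2 = 3 := by
  unfold s3
  rw [← Complex.ofReal_pow, Real.sq_sqrt (by norm_num)]
  norm_num

/-- The rescaled second variable. -/
def vv : R3 := C (s3 / 3) * X 1

lemma C_s3_sq : (C s3 : R3) ^ 2 = 3 := by
  rw [← C_pow, s3_sq]; exact map_ofNat C 3

lemma X1_eq : (X 1 : R3) = C s3 * vv := by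
  unfold vv
  rw [← mul_assoc, ← C_mul]
  have : s3 * (s3 / 3) = 1 := by linear_combination s3_sq / 3
  rw [this]; simp

lemma pderiv0_vv : pderiv 0 vv = 0 := by
  simp [vv, pderiv_X]

lemma pderiv2_vv : pderiv 2 vv = 0 := by
  simp [vv, pderiv_X]

lemma pderiv1_vv : pderiv 1 vv = C (s3 / 3) := by
  simp [vv, pderiv_X]

/-- The sextic of the statement in the rescaled coordinates. -/
def ff : R3 := JJ (X 0) vv + C (1 / 16) * (X 2 ^ 2 * (X 2 - 3) ^ 4)

/-- `z (z-1) (z-3)^3`, a multiple of the `z`-derivative. -/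
def DD : R3 := X 2 * (X 2 - 1) * (X 2 - 3) ^ 3

lemma num_C (n : ℕ) [n.AtLeastTwo] : (C (OfNat.ofNat n : ℂ) : R3) = OfNat.ofNat n :=
  map_ofNat C n

lemma pderiv0_ff : pderiv 0 ff = JX (X 0) vv := by
  have h3 : ∀ (i : Fin 3) (n : ℕ) [n.AtLeastTwo], pderiv i (OfNat.ofNat n : R3) = 0 := by
    intro i n _; rw [← num_C, pderiv_C]
  simp only [ff, JJ, JX, map_add, map_sub, map_neg, Derivation.leibniz, Derivation.leibniz_pow,
    pderiv0_vv, pderiv_X, h3, pderiv_C, Derivation.map_one_eq_zero, smul_eq_mul, nsmul_eq_mul]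
  simp
  ring

lemma pderiv1_ff : pderiv 1 ff = C (s3 / 3) * JV (X 0) vv := by
  have h3 : ∀ (i : Fin 3) (n : ℕ) [n.AtLeastTwo], pderiv i (OfNat.ofNat n : R3) = 0 := by
    intro i n _; rw [← num_C, pderiv_C]
  simp only [ff, JJ, JV, map_add, map_sub, map_neg, Derivation.leibniz, Derivation.leibniz_pow,
    pderiv1_vv, pderiv_X, h3, pderiv_C, Derivation.map_one_eq_zero, smul_eq_mul, nsmul_eq_mul]
  simp
  ring

lemma pderiv2_ff : pderiv 2 ff = C (6 / 16) * DD := by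
  have h3 : ∀ (i : Fin 3) (n : ℕ) [n.AtLeastTwo], pderiv i (OfNat.ofNat n : R3) = 0 := by
    intro i n _; rw [← num_C, pderiv_C]
  have h6 : (C (6 / 16) : R3) = 6 * C (1 / 16) := by
    rw [← num_C 6, ← C_mul]; norm_num
  simp only [ff, JJ, map_add, map_sub, map_neg, Derivation.leibniz, Derivation.leibniz_pow,
    pderiv2_vv, pderiv_X, h3, pderiv_C, Derivation.map_one_eq_zero, smul_eq_mul, nsmul_eq_mul,
    h6, DD]
  simp
  ring

/-- The Tjurina ideal, with normalized generators. -/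
def II : Ideal R3 := Ideal.span {ff, pderiv 0 ff, pderiv 1 ff, pderiv 2 ff}

lemma ff_mem : ff ∈ II := Ideal.subset_span (by simp)

lemma JX_mem : JX (X 0) vv ∈ II := by
  rw [← pderiv0_ff]; exact Ideal.subset_span (by simp)

lemma JV_mem : JV (X 0) vv ∈ II := by
  have h : C (s3 / 3) * JV (X 0) vv ∈ II := by
    rw [← pderiv1_ff]; exact Ideal.subset_span (by simp)
  have h2 := II.mul_mem_left (C s3) h
  rw [← mul_assoc, ← C_mul] at h2
  have : s3 * (s3 / 3) = 1 := by linear_combination s3_sq / 3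
  rwa [this, C_1, one_mul] at h2

lemma DD_mem : DD ∈ II := by
  have h : C (6 / 16) * DD ∈ II := by
    rw [← pderiv2_ff]; exact Ideal.subset_span (by simp)
  have h2 := II.mul_mem_left (C (16 / 6)) h
  rw [← mul_assoc, ← C_mul] at h2
  norm_num at h2
  exact h2

lemma JJ_mem : (X 2 - 1) * JJ (X 0) vv ∈ II := by
  have : (X 2 - 1) * JJ (X 0) vv = (X 2 - 1) * ff - (C (1 / 16) * X 2 * (X 2 - 3)) * DD := by
    unfold ff DD; ring
  rw [this]
  exact II.sub_mem (II.mul_mem_left _ ff_mem) (II.mul_mem_left _ DD_mem)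

/-- `z (z-3)^3`. -/
def QQ : R3 := X 2 * (X 2 - 3) ^ 3

lemma JJ1_mem : QQ * (JJ (X 0) vv + 1) ∈ II := by
  have h16 : (1 : R3) = 16 * C (1 / 16) := by
    rw [← num_C 16, ← C_mul]; norm_num
  have : QQ * (JJ (X 0) vv + 1) = QQ * ff
      - (C (1 / 16) * (X 2 - 1) * (X 2 - 4) * (4 + X 2 * (X 2 - 3) ^ 2)) * DD := by
    unfold ff DD QQ
    linear_combination (X 2 * (X 2 - 3) ^ 3) * h16
  rw [this]
  exact II.sub_mem (II.mul_mem_left _ ff_mem) (II.mul_mem_left _ DD_mem)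

/-- Index type of the spanning set. -/
abbrev Idx := (Fin 4 × {p : Fin 5 × Fin 5 // p.1.val + p.2.val ≤ 4}) ⊕ Fin 7

lemma card_Idx : Fintype.card Idx = 67 := by decide +kernel

/-- The spanning set. -/
def ww : Idx → R3
  | Sum.inl (k, p) => (X 2 - 1) * X 2 ^ k.val * (X 0 ^ p.1.1.val * vv ^ p.1.2.val)
  | Sum.inr i => QQ * (X 0 ^ ((![0, 0, 0, 1, 1, 2, 3] : Fin 7 → ℕ) i)
      * vv ^ ((![0, 1, 2, 0, 1, 0, 0] : Fin 7 → ℕ) i))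

/-- The span of the spanning set and the ideal. -/
def SS : Submodule ℂ R3 := Submodule.span ℂ (Set.range ww) ⊔ II.restrictScalars ℂ

lemma II_le {g : R3} (h : g ∈ II) : g ∈ SS := Submodule.mem_sup_right h

lemma ww_mem (i : Idx) : ww i ∈ SS :=
  Submodule.mem_sup_left (Submodule.subset_span ⟨i, rfl⟩)

lemma int_mul_mem {g : R3} (n : ℤ) (h : g ∈ SS) : (n : R3) * g ∈ SS := by
  rw [← zsmul_eq_mul]; exact zsmul_mem h n

lemma of_int_mul_mem {g : R3} (n : ℤ) (hn : n ≠ 0) (h : (n : R3) * g ∈ SS) : g ∈ SS := by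
  have h2 := SS.smul_mem ((n : ℂ)⁻¹) h
  rw [← zsmul_eq_mul, ← Int.cast_smul_eq_zsmul ℂ, smul_smul,
    inv_mul_cancel₀ (Int.cast_ne_zero.mpr hn), one_smul] at h2
  exact h2

lemma A4_mem (k a b : ℕ) (hk : k < 4) (hab : a + b ≤ 4) :
    (X 2 - 1) * X 2 ^ k * (X 0 ^ a * vv ^ b) ∈ SS :=
  ww_mem (Sum.inl (⟨k, hk⟩, ⟨(⟨a, by omega⟩, ⟨b, by omega⟩), hab⟩))

/-- Reduction step for the first block. -/
lemma stepA (k : ℕ) (N : ℤ) (hN : N ≠ 0) (m low c₁ c₂ c₃ : R3)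
    (h : (N : R3) * m = low + c₁ * JJ (X 0) vv + c₂ * JX (X 0) vv + c₃ * JV (X 0) vv)
    (hl : (X 2 - 1) * X 2 ^ k * low ∈ SS) : (X 2 - 1) * X 2 ^ k * m ∈ SS := by
  apply of_int_mul_mem N hN
  have : (N : R3) * ((X 2 - 1) * X 2 ^ k * m) = (X 2 - 1) * X 2 ^ k * low
      + ((X 2 ^ k * c₁) * ((X 2 - 1) * JJ (X 0) vv)
      + ((X 2 - 1) * X 2 ^ k * c₂) * JX (X 0) vv + ((X 2 - 1) * X 2 ^ k * c₃) * JV (X 0) vv) := by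
    linear_combination ((X 2 - 1) * X 2 ^ k) * h
  rw [this]
  exact SS.add_mem hl (II_le (II.add_mem (II.add_mem (II.mul_mem_left _ JJ_mem)
    (II.mul_mem_left _ JX_mem)) (II.mul_mem_left _ JV_mem)))

/-- Reduction step for the second block. -/
lemma stepB (N : ℤ) (hN : N ≠ 0) (m low c₁ c₂ c₃ : R3)
    (h : (N : R3) * m = low + c₁ * (JJ (X 0) vv + 1) + c₂ * JX (X 0) vv + c₃ * JV (X 0) vv)
    (hl : QQ * low ∈ SS) : QQ * m ∈ SS := by
  apply of_int_mul_mem N hN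
  have : (N : R3) * (QQ * m) = QQ * low
      + (c₁ * (QQ * (JJ (X 0) vv + 1))
      + (QQ * c₂) * JX (X 0) vv + (QQ * c₃) * JV (X 0) vv) := by
    linear_combination QQ * h
  rw [this]
  exact SS.add_mem hl (II_le (II.add_mem (II.add_mem (II.mul_mem_left _ JJ1_mem)
    (II.mul_mem_left _ JX_mem)) (II.mul_mem_left _ JV_mem)))

lemma mul_add_mem' (c p q : R3) (hp : c * p ∈ SS) (hq : c * q ∈ SS) : c * (p + q) ∈ SS := by
  rw [mul_add]; exact SS.add_mem hp hq

lemma mul_int_mem (c p : R3) (n : ℤ) (hp : c * p ∈ SS) : c * ((n : R3) * p) ∈ SS := by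
  rw [mul_left_comm]; exact int_mul_mem n hp

lemma A5_mem (k a b : ℕ) (hk : k < 4) (hab : a + b ≤ 5) :
    (X 2 - 1) * X 2 ^ k * (X 0 ^ a * vv ^ b) ∈ SS := by
  rcases Nat.lt_or_ge (a + b) 5 with h | h
  · exact A4_mem k a b hk (by omega)
  obtain rfl : b = 5 - a := by omega
  have ha : a ≤ 5 := by omega
  interval_cases a
  · refine stepA k _ (by norm_num) _ _ _ _ _ (certA0 (X 0) vv) ?_
    repeat' first | with_reducible refine mul_add_mem' _ _ _ ?_ ?_ | with_reducible refine mul_int_mem _ _ _ ?_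
    all_goals exact A4_mem k _ _ hk (by norm_num)
  · refine stepA k _ (by norm_num) _ _ _ _ _ (certA1 (X 0) vv) ?_
    repeat' first | with_reducible refine mul_add_mem' _ _ _ ?_ ?_ | with_reducible refine mul_int_mem _ _ _ ?_
    all_goals exact A4_mem k _ _ hk (by norm_num)
  · refine stepA k _ (by norm_num) _ _ _ _ _ (certA2 (X 0) vv) ?_
    repeat' first | with_reducible refine mul_add_mem' _ _ _ ?_ ?_ | with_reducible refine mul_int_mem _ _ _ ?_
    all_goals exact A4_mem k _ _ hk (by norm_num)
  · refine stepA k _ (by norm_num) _ _ _ _ _ (certA3 (X 0) vv) ?_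
    repeat' first | with_reducible refine mul_add_mem' _ _ _ ?_ ?_ | with_reducible refine mul_int_mem _ _ _ ?_
    all_goals exact A4_mem k _ _ hk (by norm_num)
  · refine stepA k _ (by norm_num) _ _ _ _ _ (certA4 (X 0) vv) ?_
    repeat' first | with_reducible refine mul_add_mem' _ _ _ ?_ ?_ | with_reducible refine mul_int_mem _ _ _ ?_
    all_goals exact A4_mem k _ _ hk (by norm_num)
  · refine stepA k _ (by norm_num) _ _ _ _ _ (certA5 (X 0) vv) ?_
    repeat' first | with_reducible refine mul_add_mem' _ _ _ ?_ ?_ | with_reducible refine mul_int_mem _ _ _ ?_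
    all_goals exact A4_mem k _ _ hk (by norm_num)

lemma B00 : QQ * (X 0 ^ 0 * vv ^ 0) ∈ SS := ww_mem (Sum.inr 0)
lemma B01 : QQ * (X 0 ^ 0 * vv ^ 1) ∈ SS := ww_mem (Sum.inr 1)
lemma B02 : QQ * (X 0 ^ 0 * vv ^ 2) ∈ SS := ww_mem (Sum.inr 2)
lemma B10 : QQ * (X 0 ^ 1 * vv ^ 0) ∈ SS := ww_mem (Sum.inr 3)
lemma B11 : QQ * (X 0 ^ 1 * vv ^ 1) ∈ SS := ww_mem (Sum.inr 4)
lemma B20 : QQ * (X 0 ^ 2 * vv ^ 0) ∈ SS := ww_mem (Sum.inr 5)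
lemma B30 : QQ * (X 0 ^ 3 * vv ^ 0) ∈ SS := ww_mem (Sum.inr 6)

lemma B03 : QQ * (X 0 ^ 0 * vv ^ 3) ∈ SS := by
  refine stepB _ (by norm_num) _ _ _ _ _ (certB03 (X 0) vv) ?_
  repeat' first | with_reducible refine mul_add_mem' _ _ _ ?_ ?_ | with_reducible refine mul_int_mem _ _ _ ?_
  all_goals first
    | with_reducible exact B00 | with_reducible exact B01 | with_reducible exact B02
    | with_reducible exact B10 | with_reducible exact B11 | with_reducible exact B20 | with_reducible exact B30

lemma B12 : QQ * (X 0 ^ 1 * vv ^ 2) ∈ SS := by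
  refine stepB _ (by norm_num) _ _ _ _ _ (certB12 (X 0) vv) ?_
  repeat' first | with_reducible refine mul_add_mem' _ _ _ ?_ ?_ | with_reducible refine mul_int_mem _ _ _ ?_
  all_goals first
    | with_reducible exact B00 | with_reducible exact B01 | with_reducible exact B02
    | with_reducible exact B10 | with_reducible exact B11 | with_reducible exact B20 | with_reducible exact B30

lemma B21 : QQ * (X 0 ^ 2 * vv ^ 1) ∈ SS := by
  refine stepB _ (by norm_num) _ _ _ _ _ (certB21 (X 0) vv) ?_
  repeat' first | with_reducible refine mul_add_mem' _ _ _ ?_ ?_ | with_reducible refine mul_int_mem _ _ _ ?_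
  all_goals first
    | with_reducible exact B00 | with_reducible exact B01 | with_reducible exact B02
    | with_reducible exact B10 | with_reducible exact B11 | with_reducible exact B20 | with_reducible exact B30

lemma B31 : QQ * (X 0 ^ 3 * vv ^ 1) ∈ SS := by
  refine stepB _ (by norm_num) _ _ _ _ _ (certB31 (X 0) vv) ?_
  repeat' first | with_reducible refine mul_add_mem' _ _ _ ?_ ?_ | with_reducible refine mul_int_mem _ _ _ ?_
  all_goals first
    | with_reducible exact B00 | with_reducible exact B01 | with_reducible exact B02
    | with_reducible exact B10 | with_reducible exact B11 | with_reducible exact B20 | with_reducible exact B30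

lemma B40 : QQ * (X 0 ^ 4 * vv ^ 0) ∈ SS := by
  refine stepB _ (by norm_num) _ _ _ _ _ (certB40 (X 0) vv) ?_
  repeat' first | with_reducible refine mul_add_mem' _ _ _ ?_ ?_ | with_reducible refine mul_int_mem _ _ _ ?_
  all_goals first
    | with_reducible exact B00 | with_reducible exact B01 | with_reducible exact B02
    | with_reducible exact B10 | with_reducible exact B11 | with_reducible exact B20 | with_reducible exact B30

lemma closed_of (y : R3) (h : ∀ i, y * ww i ∈ SS) (g : R3) (hg : g ∈ SS) : y * g ∈ SS := by
  have : SS ≤ SS.comap (LinearMap.mulLeft ℂ y) := by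
    apply sup_le
    · rw [Submodule.span_le]
      rintro _ ⟨i, rfl⟩
      exact h i
    · intro p hp
      exact II_le (II.mul_mem_left y hp)
  exact this hg

lemma closed_x (g : R3) (hg : g ∈ SS) : X 0 * g ∈ SS := by
  refine closed_of _ ?_ g hg
  rintro (⟨k, ⟨⟨a, b⟩, hp⟩⟩ | i)
  · have := A5_mem k (a + 1) b k.2 (by simp only at hp; omega)
    convert this using 1
    simp only [ww]; ring
  · fin_cases i
    · convert B10 using 1; simp [ww]; ring
    · convert B11 using 1; simp [ww]; ring
    · convert B12 using 1; simp [ww]; ring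
    · convert B20 using 1; simp [ww]; ring
    · convert B21 using 1; simp [ww]; ring
    · convert B30 using 1; simp [ww]; ring
    · convert B40 using 1; simp [ww]; ring

lemma closed_v (g : R3) (hg : g ∈ SS) : vv * g ∈ SS := by
  refine closed_of _ ?_ g hg
  rintro (⟨k, ⟨⟨a, b⟩, hp⟩⟩ | i)
  · have := A5_mem k a (b + 1) k.2 (by simp only at hp; omega)
    convert this using 1
    simp only [ww]; ring
  · fin_cases i
    · convert B01 using 1; simp [ww]; ring
    · convert B02 using 1; simp [ww]; ring
    · convert B03 using 1; simp [ww]; ring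
    · convert B11 using 1; simp [ww]; ring
    · convert B12 using 1; simp [ww]; ring
    · convert B21 using 1; simp [ww]; ring
    · convert B31 using 1; simp [ww]; ring

lemma closed_z (g : R3) (hg : g ∈ SS) : X 2 * g ∈ SS := by
  refine closed_of _ ?_ g hg
  rintro (⟨k, ⟨⟨a, b⟩, hp⟩⟩ | i)
  · simp only at hp
    rcases Nat.lt_or_ge (k.val + 1) 4 with h | h
    · have := A4_mem (k + 1) a b h hp
      convert this using 1
      simp only [ww]; ring
    · have hk : k.val = 3 := by omega
      have e : X 2 * ww (Sum.inl (k, ⟨(a, b), hp⟩)) = (X 0 ^ a.val * vv ^ b.val) * DD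
          + (((9 : ℤ) : R3) * ((X 2 - 1) * X 2 ^ 3 * (X 0 ^ a.val * vv ^ b.val))
          + ((-27 : ℤ) : R3) * ((X 2 - 1) * X 2 ^ 2 * (X 0 ^ a.val * vv ^ b.val))
          + ((27 : ℤ) : R3) * ((X 2 - 1) * X 2 ^ 1 * (X 0 ^ a.val * vv ^ b.val))) := by
        simp only [ww, hk, DD]; push_cast; ring
      rw [e]
      refine SS.add_mem (II_le (II.mul_mem_left _ DD_mem))
        (SS.add_mem (SS.add_mem (int_mul_mem _ ?_) (int_mul_mem _ ?_)) (int_mul_mem _ ?_))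
      all_goals exact A4_mem _ _ _ (by norm_num) hp
  · have e : X 2 * ww (Sum.inr i) = (X 0 ^ ((![0, 0, 0, 1, 1, 2, 3] : Fin 7 → ℕ) i)
      * vv ^ ((![0, 1, 2, 0, 1, 0, 0] : Fin 7 → ℕ) i)) * DD + ww (Sum.inr i) := by
      simp only [ww, DD, QQ]; ring
    rw [e]
    exact SS.add_mem (II_le (II.mul_mem_left _ DD_mem)) (ww_mem _)

lemma one_mem_SS : (1 : R3) ∈ SS := by
  apply of_int_mul_mem 8 (by norm_num)
  have e : ((8 : ℤ) : R3) * 1 = ((1 : ℤ) : R3) * ((X 2 - 1) * X 2 ^ 3 * (X 0 ^ 0 * vv ^ 0))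
      + ((-8 : ℤ) : R3) * ((X 2 - 1) * X 2 ^ 2 * (X 0 ^ 0 * vv ^ 0))
      + ((19 : ℤ) : R3) * ((X 2 - 1) * X 2 ^ 1 * (X 0 ^ 0 * vv ^ 0))
      + ((-8 : ℤ) : R3) * ((X 2 - 1) * X 2 ^ 0 * (X 0 ^ 0 * vv ^ 0))
      + ((-1 : ℤ) : R3) * (QQ * (X 0 ^ 0 * vv ^ 0)) := by
    simp only [QQ]; push_cast; ring
  rw [e]
  refine SS.add_mem (SS.add_mem (SS.add_mem (SS.add_mem (int_mul_mem _ ?_) (int_mul_mem _ ?_))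
    (int_mul_mem _ ?_)) (int_mul_mem _ ?_)) (int_mul_mem _ B00)
  all_goals exact A4_mem _ _ _ (by norm_num) (by norm_num)

lemma SS_top (p : R3) : p ∈ SS := by
  suffices h : ∀ p : R3, ∀ g ∈ SS, p * g ∈ SS by
    simpa using h p 1 one_mem_SS
  intro p
  induction p using MvPolynomial.induction_on with
  | C a => intro g hg; rw [← smul_eq_C_mul]; exact SS.smul_mem a hg
  | add p q hp hq => intro g hg; rw [add_mul]; exact SS.add_mem (hp g hg) (hq g hg)
  | mul_X p i hp =>
    intro g hg
    rw [mul_assoc]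
    apply hp
    fin_cases i
    · exact closed_x g hg
    · show X 1 * g ∈ SS
      rw [X1_eq, mul_assoc, ← smul_eq_C_mul]
      exact SS.smul_mem _ (closed_v g hg)
    · exact closed_z g hg

lemma span_quot : Submodule.span ℂ (Set.range (fun i => Ideal.Quotient.mkₐ ℂ II (ww i))) = ⊤ := by
  rw [eq_top_iff]
  rintro q -
  obtain ⟨p, rfl⟩ := Ideal.Quotient.mkₐ_surjective ℂ II q
  obtain ⟨g, hg, r, hr, rfl⟩ := Submodule.mem_sup.mp (SS_top p)
  have hr0 : Ideal.Quotient.mkₐ ℂ II r = 0 := Ideal.Quotient.eq_zero_iff_mem.mpr hr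
  rw [map_add, hr0, add_zero]
  have := Submodule.mem_map_of_mem (f := (Ideal.Quotient.mkₐ ℂ II).toLinearMap) hg
  rw [Submodule.map_span, ← Set.range_comp] at this
  exact this

lemma finite_quot : Module.Finite ℂ (R3 ⧸ II) :=
  ⟨Submodule.fg_def.mpr ⟨_, Set.finite_range _, span_quot⟩⟩

lemma upper : Module.finrank ℂ (R3 ⧸ II) ≤ 67 := by
  have h := finrank_range_le_card (R := ℂ) (fun i => Ideal.Quotient.mkₐ ℂ II (ww i))
  rw [Set.finrank, span_quot, finrank_top, card_Idx] at h
  exact h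

end Main

section Lower

open MvPolynomial

/-- The local moduli in the variable `z`. -/
def qq (b : Bool) : Polynomial ℂ :=
  cond b (Polynomial.X * (Polynomial.X - 3) ^ 3) (Polynomial.X - 1)

lemma qq_natDegree (b : Bool) : (qq b).natDegree = cond b 4 1 := by
  have h3 : (3 : Polynomial ℂ) = Polynomial.C 3 := (map_ofNat Polynomial.C 3).symm
  have h1 : (1 : Polynomial ℂ) = Polynomial.C 1 := by simp
  cases b
  · simp only [qq, cond_false]
    rw [h1, Polynomial.natDegree_X_sub_C]
  · simp only [qq, cond_true]
    rw [h3, Polynomial.natDegree_mul Polynomial.X_ne_zero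
      (pow_ne_zero _ (Polynomial.X_sub_C_ne_zero 3)), Polynomial.natDegree_pow,
      Polynomial.natDegree_X_sub_C, Polynomial.natDegree_X]

lemma qq_ne (b : Bool) : qq b ≠ 0 := by
  intro h
  have := qq_natDegree b
  rw [h] at this
  cases b <;> simp at this

/-- The restriction to the line over the point `(a, b)`. -/
def lineHom (a b : ℝ) : R3 →ₐ[ℂ] Polynomial ℂ :=
  aeval ![Polynomial.C (a : ℂ), Polynomial.C (s3 * b), Polynomial.X]

lemma lineHom_X0 (a b : ℝ) : lineHom a b (X 0) = Polynomial.C (a : ℂ) := by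
  simp [lineHom]

lemma lineHom_X2 (a b : ℝ) : lineHom a b (X 2) = Polynomial.X := by
  simp [lineHom]

lemma lineHom_vv (a b : ℝ) : lineHom a b vv = Polynomial.C (b : ℂ) := by
  have h : s3 / 3 * (s3 * b) = b := by linear_combination (b : ℂ) * s3_sq / 3
  simp only [vv, lineHom, map_mul, aeval_X, algHom_C, Polynomial.algebraMap_eq]
  simp only [Matrix.cons_val_one, Matrix.cons_val_zero]
  rw [← Polynomial.C_mul, ← Polynomial.C_mul, h]

lemma map_JJ {A B : Type*} [CommRing A] [CommRing B] (φ : A →+* B) (x v : A) :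
    φ (JJ x v) = JJ (φ x) (φ v) := by
  simp only [JJ, map_add, map_sub, map_neg, map_mul, map_pow, map_one, map_ofNat]

lemma map_JX {A B : Type*} [CommRing A] [CommRing B] (φ : A →+* B) (x v : A) :
    φ (JX x v) = JX (φ x) (φ v) := by
  simp only [JX, map_add, map_sub, map_neg, map_mul, map_pow, map_one, map_ofNat]

lemma map_JV {A B : Type*} [CommRing A] [CommRing B] (φ : A →+* B) (x v : A) :
    φ (JV x v) = JV (φ x) (φ v) := by
  simp only [JV, map_add, map_sub, map_neg, map_mul, map_pow, map_one, map_ofNat]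

lemma lineHom_JJ (a b : ℝ) : lineHom a b (JJ (X 0) vv) = Polynomial.C ((JJ a b : ℝ) : ℂ) := by
  have h1 := map_JJ (lineHom a b : R3 →+* Polynomial ℂ) (X 0) vv
  have h2 := map_JJ ((Polynomial.C : ℂ →+* Polynomial ℂ).comp Complex.ofRealHom) a b
  simp only [RingHom.coe_comp, Function.comp, Complex.ofRealHom_eq_coe, RingHom.coe_coe,
    lineHom_X0, lineHom_vv] at h1 h2
  rw [h1, h2]

lemma lineHom_JX (a b : ℝ) : lineHom a b (JX (X 0) vv) = Polynomial.C ((JX a b : ℝ) : ℂ) := by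
  have h1 := map_JX (lineHom a b : R3 →+* Polynomial ℂ) (X 0) vv
  have h2 := map_JX ((Polynomial.C : ℂ →+* Polynomial ℂ).comp Complex.ofRealHom) a b
  simp only [RingHom.coe_comp, Function.comp, Complex.ofRealHom_eq_coe, RingHom.coe_coe,
    lineHom_X0, lineHom_vv] at h1 h2
  rw [h1, h2]

lemma lineHom_JV (a b : ℝ) : lineHom a b (JV (X 0) vv) = Polynomial.C ((JV a b : ℝ) : ℂ) := by
  have h1 := map_JV (lineHom a b : R3 →+* Polynomial ℂ) (X 0) vv
  have h2 := map_JV ((Polynomial.C : ℂ →+* Polynomial ℂ).comp Complex.ofRealHom) a b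
  simp only [RingHom.coe_comp, Function.comp, Complex.ofRealHom_eq_coe, RingHom.coe_coe,
    lineHom_X0, lineHom_vv] at h1 h2
  rw [h1, h2]

lemma lineHom_DD (a b : ℝ) : lineHom a b DD
    = Polynomial.X * (Polynomial.X - 1) * (Polynomial.X - 3) ^ 3 := by
  simp only [DD, map_mul, map_sub, map_pow, map_one, map_ofNat, lineHom_X2]

lemma lineHom_ff (a b : ℝ) : lineHom a b ff = Polynomial.C ((JJ a b : ℝ) : ℂ)
    + Polynomial.C (1 / 16) * (Polynomial.X ^ 2 * (Polynomial.X - 3) ^ 4) := by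
  simp only [ff, map_add, map_mul, map_sub, map_pow, map_ofNat, lineHom_X2, lineHom_JJ,
    algHom_C, Polynomial.algebraMap_eq]

lemma qq_dvd (β : Bool) (a b : ℝ) (h : Crit (cond β 0 (-1)) a b) (g : R3) (hg : g ∈ II) :
    qq β ∣ lineHom a b g := by
  obtain ⟨hJ, hX, hV⟩ := h
  have hle : II ≤ (Ideal.span {qq β}).comap (lineHom a b) := by
    unfold II
    rw [Ideal.span_le]
    have hD : qq β ∣ lineHom a b DD := by
      rw [lineHom_DD]
      cases β
      · exact ⟨Polynomial.X * (Polynomial.X - 3) ^ 3, by simp only [qq, cond_false]; ring⟩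
      · exact ⟨Polynomial.X - 1, by simp only [qq, cond_true]; ring⟩
    rintro p (rfl | rfl | rfl | rfl) <;>
      simp only [SetLike.mem_coe, Ideal.mem_comap, Ideal.mem_span_singleton]
    · rw [lineHom_ff, hJ]
      cases β
      · refine ⟨Polynomial.C (1 / 16) * ((Polynomial.X - 1) * (Polynomial.X - 4)
          * (4 + Polynomial.X * (Polynomial.X - 3) ^ 2)), ?_⟩
        have h16 : (1 : Polynomial ℂ) = 16 * Polynomial.C (1 / 16) := by
          rw [← map_ofNat Polynomial.C 16, ← Polynomial.C_mul]; norm_num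
        simp only [qq, cond_false, Complex.ofReal_neg, Complex.ofReal_one, map_neg, map_one]
        linear_combination -h16
      · refine ⟨Polynomial.C (1 / 16) * (Polynomial.X * (Polynomial.X - 3)), ?_⟩
        simp only [qq, cond_true, Complex.ofReal_zero, map_zero]
        ring
    · rw [pderiv0_ff, lineHom_JX, hX]; simp
    · rw [pderiv1_ff, map_mul, lineHom_JV, hV]; simp
    · rw [pderiv2_ff, map_mul]; exact Dvd.dvd.mul_left hD _
  exact Ideal.mem_span_singleton.mp (hle hg)

lemma finrank_loc (b : Bool) :
    Module.finrank ℂ (Polynomial ℂ ⧸ Ideal.span {qq b}) = cond b 4 1 := by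
  rw [finrank_quotient_span_eq_natDegree, qq_natDegree]

lemma finite_loc (b : Bool) : Module.Finite ℂ (Polynomial ℂ ⧸ Ideal.span {qq b}) := by
  apply Module.finite_of_finrank_pos
  rw [finrank_loc]; cases b <;> simp

lemma lower : 67 ≤ Module.finrank ℂ (R3 ⧸ II) := by
  obtain ⟨a, b, hc, hm⟩ := exists_points
  let Φ : R3 →ₐ[ℂ] (∀ i : Fin 22, Polynomial ℂ ⧸ Ideal.span {qq (fl i)}) :=
    Pi.algHom ℂ _ (fun i => (Ideal.Quotient.mkₐ ℂ (Ideal.span {qq (fl i)})).comp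
      (lineHom (a i) (b i)))
  have hΦ : ∀ g ∈ II, Φ g = 0 := by
    intro g hg
    funext i
    exact Ideal.Quotient.eq_zero_iff_mem.mpr
      (Ideal.mem_span_singleton.mpr (qq_dvd _ _ _ (hc i) g hg))
  have hs : Function.Surjective Φ := by
    intro c
    choose g hg using fun i => Ideal.Quotient.mkₐ_surjective ℂ (Ideal.span {qq (fl i)}) (c i)
    let node : Fin 22 → ℂ := fun i => ((a i + 29 * b i : ℝ) : ℂ)
    have hnode : Function.Injective node := Complex.ofReal_injective.comp hm.injective
    have hline : ∀ (j : Fin 22) (p : Polynomial ℂ),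
        lineHom (a j) (b j) (Polynomial.aeval (X 0 + 29 * vv : R3) p)
          = Polynomial.C (p.eval (node j)) := by
      intro j p
      rw [← Polynomial.aeval_algHom_apply, map_add, map_mul, map_ofNat, lineHom_X0, lineHom_vv]
      have e : (Polynomial.C (a j : ℂ) + 29 * Polynomial.C (b j : ℂ) : Polynomial ℂ)
          = algebraMap ℂ (Polynomial ℂ) (node j) := by
        rw [Polynomial.algebraMap_eq, ← map_ofNat Polynomial.C 29, ← Polynomial.C_mul,
          ← Polynomial.C_add]
        simp [node]
      rw [e, Polynomial.aeval_algebraMap_apply, Polynomial.algebraMap_eq]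
      simp
    have hz : ∀ (j : Fin 22) (p : Polynomial ℂ),
        lineHom (a j) (b j) (Polynomial.aeval (X 2 : R3) p) = p := by
      intro j p
      rw [← Polynomial.aeval_algHom_apply, lineHom_X2, Polynomial.aeval_X_left_apply]
    refine ⟨∑ i, Polynomial.aeval (X 0 + 29 * vv : R3) (Lagrange.basis Finset.univ node i)
      * Polynomial.aeval (X 2 : R3) (g i), ?_⟩
    funext j
    rw [← hg j]
    show Ideal.Quotient.mkₐ ℂ (Ideal.span {qq (fl j)}) (lineHom (a j) (b j) _) = _
    congr 1
    rw [map_sum, Finset.sum_eq_single j]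
    · rw [map_mul, hline, hz, Lagrange.eval_basis_self hnode.injOn (Finset.mem_univ j)]
      simp
    · intro i _ hij
      rw [map_mul, hline, hz, Lagrange.eval_basis_of_ne hij (Finset.mem_univ j)]
      simp
    · simp
  have hfin := finite_loc
  have := finite_quot
  let Ψ := Ideal.Quotient.liftₐ II Φ hΦ
  have hΨ : Function.Surjective Ψ := by
    intro c
    obtain ⟨g, rfl⟩ := hs c
    exact ⟨Ideal.Quotient.mk II g, rfl⟩
  have h := LinearMap.finrank_le_finrank_of_surjective (f := Ψ.toLinearMap) hΨ
  rw [Module.finrank_pi_fintype] at h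
  simp only [finrank_loc] at h
  have hsum : ∑ i : Fin 22, cond (fl i) 4 1 = 67 := by decide +kernel
  rwa [hsum] at h

end Lower


open MvPolynomial in
/-- The total Tjurina number of the sextic `f = J₆(x,y) + (z⁶-12z⁵+54z⁴-108z³+81z²)/16`
is 67. -/
theorem stmt9 (f : MvPolynomial (Fin 3) ℂ)
    (hf : f = C (-1) + C 12 * X 0 ^ 2 - C 4 * X 0 ^ 3 - C 9 * X 0 ^ 4 + C 6 * X 0 ^ 5 - X 0 ^ 6 - C 24 * C ((Real.sqrt 3 : ℝ) : ℂ) * X 0 ^ 2 * X 1 + C 18 * C ((Real.sqrt 3 : ℝ) : ℂ) * X 0 ^ 4 * X 1 - C 6 * C ((Real.sqrt 3 : ℝ) : ℂ) * X 0 ^ 5 * X 1 + C 12 * X 1 ^ 2 + C 12 * X 0 * X 1 ^ 2 - C 18 * X 0 ^ 2 * X 1 ^ 2 - C 12 * X 0 ^ 3 * X 1 ^ 2 + C 15 * X 0 ^ 4 * X 1 ^ 2 + C 8 * C ((Real.sqrt 3 : ℝ) : ℂ) * X 1 ^ 3 + C 12 * C ((Real.sqrt 3 : ℝ) : ℂ)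 * X 0 ^ 2 * X 1 ^ 3 + C 20 * C ((Real.sqrt 3 : ℝ) : ℂ) * X 0 ^ 3 * X 1 ^ 3 - C 9 * X 1 ^ 4 - C 18 * X 0 * X 1 ^ 4 - C 15 * X 0 ^ 2 * X 1 ^ 4 - C 6 * C ((Real.sqrt 3 : ℝ) : ℂ) * X 1 ^ 5 - C 6 * C ((Real.sqrt 3 : ℝ) : ℂ) * X 0 * X 1 ^ 5 + X 1 ^ 6
      + C (1 / 16) * (X 2 ^ 6 - C 12 * X 2 ^ 5 + C 54 * X 2 ^ 4 - C 108 * X 2 ^ 3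
          + C 81 * X 2 ^ 2)) :
    Module.finrank ℂ
      (MvPolynomial (Fin 3) ℂ ⧸
        Ideal.span ({f, pderiv 0 f, pderiv 1 f, pderiv 2 f} :
          Set (MvPolynomial (Fin 3) ℂ))) = 67 := by
  have hff : f = ff := by
    have h2 : C ((Real.sqrt 3 : ℝ) : ℂ) ^ 2 = (3 : MvPolynomial (Fin 3) ℂ) := C_s3_sq
    rw [hf, ff, X1_eq]
    change _ = JJ (X 0) vv + _
    have hn : ∀ (n : ℕ) [n.AtLeastTwo], (C (OfNat.ofNat n : ℂ) : MvPolynomial (Fin 3) ℂ)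
      = OfNat.ofNat n := fun n _ => map_ofNat C n
    simp only [JJ, hn, C_neg, C_1]
    change C s3 ^ 2 = (3 : MvPolynomial (Fin 3) ℂ) at h2
    rw [show (((Real.sqrt 3 : ℝ) : ℂ)) = s3 from rfl]
    generalize (C s3 : MvPolynomial (Fin 3) ℂ) = r at h2 ⊢
    generalize vv = v
    have h4 : r ^ 4 = 9 := by linear_combination (r ^ 2 + 3) * h2
    have h6 : r ^ 6 = 27 := by linear_combination (r ^ 4 + 3 * r ^ 2 + 9) * h2
    linear_combination (12*v^2 + 12*X 0*v^2 - 24*X 0^2*v - 18*X 0^2*v^2 - 12*X 0^3*v^2 + 18*X 0^4*v + 15*X 0^4*v^2 - 6*X 0^5*v) * h2 + (8*v^3 - 9*v^4 - 18*X 0*v^4 + 12*X 0^2*v^3 - 15*X 0^2*v^4 + 20*X 0^3*v^3) * h4 + (-6*v^5 + v^6 - 6*X 0*v^5) * h6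
  subst hff
  exact le_antisymm upper lower
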